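/- arXiv:2309.05547 — 2 statements merged into one kernel-verified Lean document; each statement's English description precedes it below -/
import Mathlib

section
/- For each nonnegative integer n, the group Stab(7^{(n)}) is presented by the generators x, a₀, a₁, …, a_n and the relations: x⁴ = 1; x² = a₀² = ⋯ = a_n²; (x·a_i)⁴ = 1 for 0 ≤ i ≤ n; [a_i, a_j] = [a_{i+k}, a_{j+k}] for all 0 ≤ i < j with j + k ≤ n; and [x, a_i] = [a_{k-1}, a_{i+k}] for all 0 ≤ i and 1 ≤ k ≤ n − i. Precisely, the homomorphism from the free group on the n+2 generators x, a₀, …, a_n onto Stab(7^{(n)}) sending each generator to the corresponding element is surjective with kernel the normal closure of the corresponding set of relators. -/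
/-!
Common setup: the commutator convention `[a,b] = a⁻¹b⁻¹ab` of the paper, the sequence
`x₀ = x`, `x_{i+1} = [yxy, x_i]`, the Laurent polynomial ring `R = 𝔽₂[t,t⁻¹]`, and the
images `X`, `Y` of `σ₁σ₂σ₃` and `σ₁σ₂σ₃σ₁` in `GL(3, R)` under the mod-2 reduced Burau
representation of the 4-strand braid group.
-/

open Matrix LaurentPolynomial

noncomputable section

set_option maxRecDepth 100000

/-- The paper's commutator convention: `[a,b] = a⁻¹b⁻¹ab`. -/
def br {G : Type*} [Group G] (a b : G) : G := a⁻¹ * b⁻¹ * a * b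

/-- The recursively defined elements `x₀ = x`, `x_{i+1} = [yxy, x_i]`. -/
def xseq {G : Type*} [Group G] (x y : G) : ℕ → G
  | 0 => x
  | n + 1 => br (y * x * y) (xseq x y n)

/-- `R = 𝔽₂[t,t⁻¹]`, the ring of Laurent polynomials over the field with two elements. -/
abbrev R2 : Type := LaurentPolynomial (ZMod 2)

instance : CharP R2 2 := charP_of_injective_algebraMap (algebraMap (ZMod 2) R2).injective 2

/-- The matrix `X = t·!![0,0,1; 1,0,1; 0,1,1]`. -/
def Xmat : Matrix (Fin 3) (Fin 3) R2 := (T 1 : R2) • !![0,0,1; 1,0,1; 0,1,1]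

/-- The matrix `Y = t·!![0,0,1; t,1,1; 0,1,1]`. -/
def Ymat : Matrix (Fin 3) (Fin 3) R2 := (T 1 : R2) • !![0,0,1; T 1,1,1; 0,1,1]

/-- An explicit inverse for `Xmat`. -/
def Xmatinv : Matrix (Fin 3) (Fin 3) R2 := (T (-1) : R2) • !![1,1,0; 1,0,1; 1,0,0]

/-- An explicit inverse for `Ymat`. -/
def Ymatinv : Matrix (Fin 3) (Fin 3) R2 := (T (-2) : R2) • !![0,1,1; T 1,0,T 1; T 1,0,0]

lemma Xmat_mul_Xmatinv : Xmat * Xmatinv = 1 := by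
  rw [Xmat, Xmatinv, Matrix.smul_mul, Matrix.mul_smul, smul_smul, ← T_add]
  simp only [Matrix.mul_fin_three, mul_zero, zero_mul, mul_one, one_mul, add_zero, zero_add,
    ← T_add, CharTwo.add_self_eq_zero]
  rw [Matrix.one_fin_three]
  simp only [Matrix.smul_of, Matrix.smul_cons, smul_eq_mul, Matrix.smul_empty, ← T_add,
    mul_zero, mul_one]
  norm_num [T_zero]

lemma Xmatinv_mul_Xmat : Xmatinv * Xmat = 1 := by
  rw [Xmat, Xmatinv, Matrix.smul_mul, Matrix.mul_smul, smul_smul, ← T_add]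
  simp only [Matrix.mul_fin_three, mul_zero, zero_mul, mul_one, one_mul, add_zero, zero_add,
    ← T_add, CharTwo.add_self_eq_zero]
  rw [Matrix.one_fin_three]
  simp only [Matrix.smul_of, Matrix.smul_cons, smul_eq_mul, Matrix.smul_empty, ← T_add,
    mul_zero, mul_one]
  norm_num [T_zero]

lemma Ymat_mul_Ymatinv : Ymat * Ymatinv = 1 := by
  rw [Ymat, Ymatinv, Matrix.smul_mul, Matrix.mul_smul, smul_smul, ← T_add]
  simp only [Matrix.mul_fin_three, mul_zero, zero_mul, mul_one, one_mul, add_zero, zero_add,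
    ← T_add, CharTwo.add_self_eq_zero]
  rw [Matrix.one_fin_three]
  simp only [Matrix.smul_of, Matrix.smul_cons, smul_eq_mul, Matrix.smul_empty, ← T_add,
    mul_zero, mul_one]
  norm_num [T_zero]

lemma Ymatinv_mul_Ymat : Ymatinv * Ymat = 1 := by
  rw [Ymat, Ymatinv, Matrix.mul_smul, Matrix.smul_mul, smul_smul, ← T_add]
  simp only [Matrix.mul_fin_three, mul_zero, zero_mul, mul_one, one_mul, add_zero, zero_add,
    ← T_add, CharTwo.add_self_eq_zero]
  rw [Matrix.one_fin_three]
  simp only [Matrix.smul_of, Matrix.smul_cons, smul_eq_mul, Matrix.smul_empty, ← T_add,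
    mul_zero, mul_one]
  norm_num [T_zero]

/-- `X ∈ GL(3, 𝔽₂[t,t⁻¹])`, the mod-2 reduced Burau image of `σ₁σ₂σ₃`. -/
def X : GL (Fin 3) R2 := ⟨Xmat, Xmatinv, Xmat_mul_Xmatinv, Xmatinv_mul_Xmat⟩

/-- `Y ∈ GL(3, 𝔽₂[t,t⁻¹])`, the mod-2 reduced Burau image of `σ₁σ₂σ₃σ₁`. -/
def Y : GL (Fin 3) R2 := ⟨Ymat, Ymatinv, Ymat_mul_Ymatinv, Ymatinv_mul_Ymat⟩

/-- `PGL(3, R)`, the projective general linear group: `GL(3,R)` modulo its center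
(the subgroup of scalars). -/
abbrev PGL3 : Type := GL (Fin 3) R2 ⧸ Subgroup.center (GL (Fin 3) R2)

/-- The natural projection `p : GL(3,R) → PGL(3,R)`. -/
def pp : GL (Fin 3) R2 →* PGL3 := QuotientGroup.mk' (Subgroup.center (GL (Fin 3) R2))

/-- `Q_{4,2}`, the subgroup of `PGL(3,R)` generated by `x = p(X)` and `y = p(Y)`. -/
abbrev Q42 : Subgroup PGL3 := Subgroup.closure {pp X, pp Y}

/-- The element `yxy` of `Q_{4,2} ≤ PGL(3,R)`. -/
def wYXY : PGL3 := pp Y * pp X * pp Y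

/-- The elements `a_i = (yxy)^{i+1}·x·(yxy)^{-(i+1)}`. -/
def aEl (i : ℕ) : PGL3 := wYXY ^ (i + 1) * pp X * (wYXY ^ (i + 1))⁻¹

/-- The subgroup `Stab(7^{(n)}) = ⟨x, a₀, a₁, …, a_n⟩` of `Q_{4,2} ≤ PGL(3,R)`. -/
def Stab (n : ℕ) : Subgroup PGL3 :=
  Subgroup.closure ({pp X} ∪ {g | ∃ i ≤ n, g = aEl i})

/-- The homomorphism from the free group on the `n+2` generators `x, a₀, …, a_n`
sending each generator to the corresponding element of `PGL(3,R)`. -/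
def φStabA (n : ℕ) : FreeGroup (Fin (n + 2)) →* PGL3 :=
  FreeGroup.lift (Fin.cases (pp X) fun i : Fin (n + 1) => aEl i)

/-- The relators of Theorem A.1: `x⁴`; `x² = a_i²`; `(x·a_i)⁴`;
`[a_i,a_j] = [a_{i+k},a_{j+k}]` for `0 ≤ i < j`, `j+k ≤ n`; and
`[x,a_i] = [a_{k-1},a_{i+k}]` for `0 ≤ i`, `1 ≤ k ≤ n-i`. Here generator `0` is `x` and
generator `i+1` is `a_i`. -/
def stabRelsA (n : ℕ) : Set (FreeGroup (Fin (n + 2))) :=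
  {(FreeGroup.of (0 : Fin (n + 2))) ^ 4} ∪
    {r | ∃ i : ℕ, ∃ _ : i ≤ n, r =
      (FreeGroup.of (0 : Fin (n + 2))) ^ 2 *
        ((FreeGroup.of (⟨i + 1, by omega⟩ : Fin (n + 2))) ^ 2)⁻¹} ∪
    {r | ∃ i : ℕ, ∃ _ : i ≤ n, r =
      (FreeGroup.of (0 : Fin (n + 2)) *
        FreeGroup.of (⟨i + 1, by omega⟩ : Fin (n + 2))) ^ 4} ∪
    {r | ∃ i j k : ℕ, ∃ _ : i < j ∧ j + k ≤ n, r =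
      br (FreeGroup.of (⟨i + 1, by omega⟩ : Fin (n + 2)))
          (FreeGroup.of (⟨j + 1, by omega⟩ : Fin (n + 2))) *
        (br (FreeGroup.of (⟨i + k + 1, by omega⟩ : Fin (n + 2)))
          (FreeGroup.of (⟨j + k + 1, by omega⟩ : Fin (n + 2))))⁻¹} ∪
    {r | ∃ i k : ℕ, ∃ _ : 1 ≤ k ∧ k ≤ n - i, r =
      br (FreeGroup.of (0 : Fin (n + 2)))
          (FreeGroup.of (⟨i + 1, by omega⟩ : Fin (n + 2))) *
        (br (FreeGroup.of (⟨k, by omega⟩ : Fin (n + 2)))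
          (FreeGroup.of (⟨i + k + 1, by omega⟩ : Fin (n + 2))))⁻¹}

/-! ### The Heisenberg group -/

@[ext] structure Hs where
  a : R2
  b : R2
  c : R2

namespace Hs

instance : Mul Hs := ⟨fun p q => ⟨p.a + q.a, p.b + q.b, p.c + q.c + p.a * q.b⟩⟩
instance : One Hs := ⟨⟨0, 0, 0⟩⟩
instance : Inv Hs := ⟨fun p => ⟨-p.a, -p.b, -p.c + p.a * p.b⟩⟩

@[simp] lemma mul_a (p q : Hs) : (p * q).a = p.a + q.a := rfl
@[simp] lemma mul_b (p q : Hs) : (p * q).b = p.b + q.b := rfl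
@[simp] lemma mul_c (p q : Hs) : (p * q).c = p.c + q.c + p.a * q.b := rfl
@[simp] lemma one_a : (1 : Hs).a = 0 := rfl
@[simp] lemma one_b : (1 : Hs).b = 0 := rfl
@[simp] lemma one_c : (1 : Hs).c = 0 := rfl
@[simp] lemma inv_a (p : Hs) : (p⁻¹).a = -p.a := rfl
@[simp] lemma inv_b (p : Hs) : (p⁻¹).b = -p.b := rfl
@[simp] lemma inv_c (p : Hs) : (p⁻¹).c = -p.c + p.a * p.b := rfl

instance : Group Hs :=
  Group.ofLeftAxioms
    (by intro p q r; ext1 <;> simp <;> ring)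
    (by intro p; ext1 <;> simp)
    (by intro p; ext1 <;> simp)

/-- The unitriangular matrix. -/
def toMat (p : Hs) : Matrix (Fin 3) (Fin 3) R2 := !![1, p.a, p.c; 0, 1, p.b; 0, 0, 1]

lemma toMat_mul (p q : Hs) : toMat (p * q) = toMat p * toMat q := by
  simp only [toMat, Matrix.mul_fin_three, mul_a, mul_b, mul_c]
  congr! 4 <;> ring_nf

lemma toMat_one : toMat 1 = 1 := by
  rw [Matrix.one_fin_three]; rfl

/-- First coordinate as a homomorphism. -/
def aHom : Hs →* Multiplicative R2 where
  toFun p := Multiplicative.ofAdd p.a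
  map_one' := rfl
  map_mul' _ _ := rfl

/-- Central embedding. -/
def cHom : Multiplicative R2 →* Hs where
  toFun r := ⟨0, 0, r.toAdd⟩
  map_one' := rfl
  map_mul' r s := by ext1 <;> simp

/-- The images of the generators. -/
def gen (i : ℕ) : Hs := ⟨T i, (1 + T 1) * T (-i), 1⟩

lemma two : (2 : R2) = 0 := CharTwo.two_eq_zero

lemma TT (i : ℤ) : (T i : R2) * T (-i) = 1 := by rw [← T_add]; simp

lemma gen_sq (i : ℕ) : gen i ^ 2 = cHom (Multiplicative.ofAdd (1 + T 1)) := by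
  rw [pow_two]
  ext1
  · simp [gen, cHom, CharTwo.add_self_eq_zero]
  · simp [gen, cHom, CharTwo.add_self_eq_zero]
  · simp only [gen, cHom, mul_c, MonoidHom.coe_mk, OneHom.coe_mk, toAdd_ofAdd]
    linear_combination (1 + T 1) * TT i + two

lemma br_gen (i d : ℕ) : br (gen i) (gen (i + d)) =
    cHom (Multiplicative.ofAdd ((1 + T 1) * (T d + T (-d)))) := by
  have e1 : (T ((i + d : ℕ) : ℤ) : R2) = T i * T d := by rw [← T_add]; simp
  have e2 : (T (-((i + d : ℕ) : ℤ)) : R2) = T (-i) * T (-d) := by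
    rw [← T_add]; congr 1; push_cast; ring
  ext1
  · simp [br, gen, cHom]
  · simp [br, gen, cHom]
  · simp only [br, gen, cHom, mul_c, mul_a, mul_b, inv_a, inv_b, inv_c, MonoidHom.coe_mk,
      OneHom.coe_mk, toAdd_ofAdd, e1, e2]
    linear_combination (1 + T 1) * (T (-d) - T d) * TT i - (1 + T 1) * T d * two

lemma br_gen_sq (d : ℕ) : (br (gen 0) (gen d)) ^ 2 = 1 := by
  have := br_gen 0 d
  rw [zero_add] at this
  rw [this, ← map_pow, ← ofAdd_nsmul, two_nsmul, CharTwo.add_self_eq_zero]; rfl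

lemma pow_four (p : Hs) : p ^ 4 = 1 := by
  have h : p * p = cHom (Multiplicative.ofAdd (p.a * p.b)) := by
    ext1
    · exact CharTwo.add_self_eq_zero _
    · exact CharTwo.add_self_eq_zero _
    · show p.c + p.c + p.a * p.b = p.a * p.b
      rw [CharTwo.add_self_eq_zero, zero_add]
  rw [show 4 = 2 * 2 from rfl, pow_mul, pow_two p, h, ← map_pow, ← ofAdd_nsmul, two_nsmul,
    CharTwo.add_self_eq_zero]
  rfl

end Hs

/-! ### Comparison with the matrices -/

lemma gen_XP {R : Type*} [CommRing R] (h2 : (2 : R) = 0) (t : R) :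
    (t • !![0,0,1; 1,0,1; 0,1,1]) * !![1, 0, 0; 0, 1, t; 1, 1, 1] =
      t • (!![1, 0, 0; 0, 1, t; 1, 1, 1] * !![1, 1, 1; 0, 1, 1 + t; 0, 0, 1]) := by
  ext i j
  fin_cases i <;> fin_cases j <;> simp [Matrix.mul_apply, Fin.sum_univ_three] <;> grind

lemma gen_WP {R : Type*} [CommRing R] (h2 : (2 : R) = 0) (t : R) :
    ((t • !![0,0,1; t,1,1; 0,1,1]) * (t • !![0,0,1; 1,0,1; 0,1,1]) *
      (t • !![0,0,1; t,1,1; 0,1,1])) * !![1, 0, 0; 0, 1, t; 1, 1, 1] =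
      !![1, 0, 0; 0, 1, t; 1, 1, 1] * !![t ^ 4, 0, 0; 0, t ^ 3, 0; 0, 0, t ^ 4] := by
  ext i j
  fin_cases i <;> fin_cases j <;> simp [Matrix.mul_apply, Fin.sum_univ_three] <;> grind

lemma gen_D {R : Type*} [CommRing R] (t t' u v : R) (h : t * t' = 1) :
    !![t ^ 4, 0, 0; 0, t ^ 3, 0; 0, 0, t ^ 4] * !![1, u, 1; 0, 1, (1 + t) * v; 0, 0, 1] =
    !![1, u * t, 1; 0, 1, (1 + t) * (v * t'); 0, 0, 1] *
      !![t ^ 4, 0, 0; 0, t ^ 3, 0; 0, 0, t ^ 4] := by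
  ext i j
  fin_cases i <;> fin_cases j <;> simp [Matrix.mul_apply, Fin.sum_univ_three]
  · ring
  · linear_combination (-(1 + t) * v * t ^ 3) * h

/-- Change of basis. -/
def Pm : Matrix (Fin 3) (Fin 3) R2 := !![1, 0, 0; 0, 1, T 1; 1, 1, 1]

lemma one_add_T_ne : (1 + T 1 : R2) ≠ 0 := by
  intro h
  rw [← T_zero] at h
  have := congrArg (fun p : R2 => p.coeff 1) h
  simp only [AddMonoidAlgebra.coeff_add, Finsupp.add_apply, T_apply] at this
  simp at this

lemma Pm_det : Pm.det = 1 + T 1 := by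
  simp [Pm, Matrix.det_fin_three]
  linear_combination - T 1 * Hs.two

lemma Pm_left {B C : Matrix (Fin 3) (Fin 3) R2} (h : Pm * B = Pm * C) : B = C := by
  have h2 := congrArg (Pm.adjugate * ·) h
  simp only [← mul_assoc, Matrix.adjugate_mul, Pm_det, Matrix.smul_mul, one_mul] at h2
  exact smul_right_injective _ one_add_T_ne h2

lemma Pm_right {B C : Matrix (Fin 3) (Fin 3) R2} (h : B * Pm = C * Pm) : B = C := by
  have h2 := congrArg (· * Pm.adjugate) h
  simp only [mul_assoc, Matrix.mul_adjugate, Pm_det, Matrix.mul_smul, mul_one] at h2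
  exact smul_right_injective _ one_add_T_ne h2

/-- The correspondence between matrices (up to scalars) and the Heisenberg group. -/
def Corr : Subgroup (GL (Fin 3) R2 × Hs) where
  carrier := {q | ∃ k : ℤ, q.1.val * Pm = (T k : R2) • (Pm * q.2.toMat)}
  one_mem' := ⟨0, by simp [Hs.toMat_one]⟩
  mul_mem' := by
    rintro ⟨A, p⟩ ⟨B, q⟩ ⟨k, hk⟩ ⟨l, hl⟩
    refine ⟨k + l, ?_⟩
    simp only [Prod.mk_mul_mk, Units.val_mul, Hs.toMat_mul] at *
    rw [mul_assoc, hl, Matrix.mul_smul, ← mul_assoc, hk, Matrix.smul_mul, smul_smul, T_add,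
      mul_assoc, mul_comm (T l)]
  inv_mem' := by
    rintro ⟨A, p⟩ ⟨k, hk⟩
    refine ⟨-k, ?_⟩
    simp only [Prod.inv_mk] at *
    have h1 : (A⁻¹).val * (A.val * Pm) * (p⁻¹).toMat
        = (A⁻¹).val * ((T k : R2) • (Pm * p.toMat)) * (p⁻¹).toMat := by rw [hk]
    rw [← mul_assoc, ← Units.val_mul, inv_mul_cancel, Units.val_one, one_mul, Matrix.mul_smul,
      Matrix.smul_mul, mul_assoc, mul_assoc, ← Hs.toMat_mul, mul_inv_cancel, Hs.toMat_one,
      mul_one] at h1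
    rw [h1, smul_smul, ← T_add]; simp

/-- The matrix of `yxy`. -/
def Wg : GL (Fin 3) R2 := Y * X * Y

def Dm : Matrix (Fin 3) (Fin 3) R2 := !![T 4, 0, 0; 0, T 3, 0; 0, 0, T 4]
def Dmi : Matrix (Fin 3) (Fin 3) R2 := !![T (-4), 0, 0; 0, T (-3), 0; 0, 0, T (-4)]

lemma Dm_Dmi : Dm * Dmi = 1 := by
  rw [Matrix.one_fin_three, Dm, Dmi, Matrix.mul_fin_three]
  simp only [mul_zero, zero_mul, add_zero, zero_add, Hs.TT]

lemma T2 : (T 2 : R2) = T 1 ^ 2 := by simp [T_pow]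
lemma T3 : (T 3 : R2) = T 1 ^ 3 := by simp [T_pow]
lemma T4 : (T 4 : R2) = T 1 ^ 4 := by simp [T_pow]

lemma Dm_eq : Dm = !![T 1 ^ 4, 0, 0; 0, T 1 ^ 3, 0; 0, 0, T 1 ^ 4] := by
  rw [Dm, T3, T4]

lemma XP : X.val * Pm = (T 1 : R2) • (Pm * (Hs.gen 0).toMat) := by
  have : (Hs.gen 0).toMat = !![1, 1, 1; 0, 1, 1 + T 1; 0, 0, 1] := by
    simp only [Hs.toMat, Hs.gen, Nat.cast_zero, neg_zero, T_zero, mul_one]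
  rw [this]
  exact gen_XP Hs.two (T 1)

lemma WP : Wg.val * Pm = Pm * Dm := by
  rw [Dm_eq]
  exact gen_WP Hs.two (T 1)

lemma D_gen (i : ℕ) : Dm * (Hs.gen i).toMat = (Hs.gen (i + 1)).toMat * Dm := by
  have e1 : (T ((i + 1 : ℕ) : ℤ) : R2) = T i * T 1 := by rw [← T_add]; simp
  have e2 : (T (-((i + 1 : ℕ) : ℤ)) : R2) = T (-i) * T (-1) := by
    rw [← T_add]; congr 1; push_cast; ring
  have := gen_D (T 1 : R2) (T (-1)) (T i) (T (-i)) (Hs.TT 1)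
  rw [← e1, ← e2, ← Dm_eq] at this
  exact this

/-- The lifted generators. -/
def gMat (i : ℕ) : GL (Fin 3) R2 := Wg ^ i * X * (Wg ^ i)⁻¹

lemma gMat_mem (i : ℕ) : (gMat i).val * Pm = (T 1 : R2) • (Pm * (Hs.gen i).toMat) := by
  induction i with
  | zero => simpa [gMat] using XP
  | succ i ih =>
    have h : gMat (i + 1) * Wg = Wg * gMat i := by
      simp only [gMat, pow_succ']; group
    have h' := congrArg (fun A : GL (Fin 3) R2 => A.val * Pm * Dmi) h
    simp only [Units.val_mul] at h'
    rw [mul_assoc _ Wg.val, WP, mul_assoc, mul_assoc Pm, Dm_Dmi, mul_one, mul_assoc Wg.val, ih,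
      Matrix.mul_smul, ← mul_assoc, WP, mul_assoc Pm, D_gen, Matrix.smul_mul, mul_assoc,
      mul_assoc, Dm_Dmi, mul_one] at h'
    exact h'

/-- Lift of `φStabA`. -/
def Flift (n : ℕ) : FreeGroup (Fin (n + 2)) →* GL (Fin 3) R2 :=
  FreeGroup.lift fun i => gMat i

def Ulift (n : ℕ) : FreeGroup (Fin (n + 2)) →* Hs :=
  FreeGroup.lift fun i => Hs.gen i

lemma pp_Flift (n : ℕ) : pp.comp (Flift n) = φStabA n := by
  apply FreeGroup.ext_hom
  intro i
  refine Fin.cases ?_ (fun j => ?_) i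
  · simp [Flift, φStabA, gMat]
  · simp [Flift, φStabA, gMat, aEl, wYXY, Wg]

lemma corr (n : ℕ) (f : FreeGroup (Fin (n + 2))) : (Flift n f, Ulift n f) ∈ Corr := by
  have : ((Flift n).prod (Ulift n)).range ≤ Corr := by
    have : (Flift n).prod (Ulift n) = FreeGroup.lift fun i : Fin (n + 2) => (gMat i, Hs.gen i) := by
      apply FreeGroup.ext_hom
      intro i
      simp [Flift, Ulift]
    rw [this, FreeGroup.range_lift_eq_closure, Subgroup.closure_le]
    rintro _ ⟨i, rfl⟩
    exact ⟨1, gMat_mem i⟩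
  exact this ⟨f, rfl⟩

lemma ker_eq (n : ℕ) : (φStabA n).ker = (Ulift n).ker := by
  ext f
  rw [← pp_Flift, MonoidHom.mem_ker, MonoidHom.mem_ker, MonoidHom.comp_apply, pp,
    QuotientGroup.mk'_apply, QuotientGroup.eq_one_iff,
    Matrix.GeneralLinearGroup.mem_center_iff_val_mem_range_scalar]
  obtain ⟨k, hk⟩ := corr n f
  simp only at hk
  constructor
  · rintro ⟨r, hr⟩
    rw [← hr, Matrix.scalar_apply, ← Matrix.smul_one_eq_diagonal, Matrix.smul_mul, one_mul] at hk
    have h2 : r • (1 : Matrix (Fin 3) (Fin 3) R2) = (T k : R2) • (Ulift n f).toMat := by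
      apply Pm_left
      rw [Matrix.mul_smul, Matrix.mul_smul, mul_one, hk]
    have e := fun i j => congrFun (congrFun h2 i) j
    have hT := (isUnit_T (R := ZMod 2) k).ne_zero
    have e1 := e 0 1
    have e2 := e 1 2
    have e3 := e 0 2
    simp [Hs.toMat, hT] at e1 e2 e3
    exact Hs.ext e1 e2 e3
  · intro h
    refine ⟨T k, ?_⟩
    apply Pm_right
    rw [hk, h, Hs.toMat_one, mul_one, Matrix.scalar_apply, ← Matrix.smul_one_eq_diagonal,
      Matrix.smul_mul, one_mul]

lemma range_eq (n : ℕ) : (φStabA n).range = Stab n := by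
  rw [φStabA, FreeGroup.range_lift_eq_closure, Stab]
  congr 1
  ext g
  simp only [Set.mem_range, Set.mem_union, Set.mem_singleton_iff, Set.mem_ofPred_eq]
  constructor
  · rintro ⟨i, rfl⟩
    refine Fin.cases ?_ (fun j => ?_) i
    · left; rfl
    · right; exact ⟨j, by omega, rfl⟩
  · rintro (rfl | ⟨i, hi, rfl⟩)
    · exact ⟨0, rfl⟩
    · exact ⟨Fin.succ ⟨i, by omega⟩, rfl⟩

/-! ### Group theory -/

/-- Exponent sum of a generator. -/
def ex {ι : Type*} [DecidableEq ι] (f : FreeGroup ι) (i : ι) : ℤ :=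
  (FreeGroup.lift (fun j => Multiplicative.ofAdd (if j = i then (1 : ℤ) else 0)) f).toAdd

lemma lift_comm {ι A : Type*} [DecidableEq ι] [Fintype ι] [CommGroup A] (g : ι → A)
    (f : FreeGroup ι) : FreeGroup.lift g f = ∏ i, g i ^ ex f i := by
  induction f using FreeGroup.induction_on with
  | C1 => simp [ex]
  | of j => simp [ex, Finset.prod_ite_eq]
  | inv_of j h => simp only [map_inv, h, ex, toAdd_inv, _root_.zpow_neg, Finset.prod_inv_distrib]
  | mul x y hx hy => simp only [map_mul, hx, hy, ex, toAdd_mul, _root_.zpow_add, Finset.prod_mul_distrib]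

lemma even_of_sum {N : ℕ} (e : Fin (N + 1) → ℤ) (s : Fin (N + 1) → R2)
    (hs : ∀ i j : Fin (N + 1), (s i).coeff (j : ℤ) = if i = j then 1 else 0)
    (h : ∑ i, e i • s i = 0) (j : Fin (N + 1)) : Even (e j) := by
  let L : R2 →+ ZMod 2 :=
    { toFun := fun p => p.coeff (j : ℤ), map_zero' := rfl, map_add' := fun _ _ => rfl }
  have h1 := congrArg L h
  rw [map_sum] at h1
  simp only [map_zsmul] at h1
  have h2 : ∀ i, L (s i) = if i = j then 1 else 0 := fun i => hs i j
  simp only [h2] at h1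
  simp at h1
  rw [even_iff_two_dvd]
  exact (ZMod.intCast_zmod_eq_zero_iff_dvd (e j) 2).1 h1

lemma prod_even {ι A : Type*} [Fintype ι] [CommGroup A] (g : ι → A) (e : ι → ℤ)
    (hg : ∀ i, g i ^ 2 = 1) (he : ∀ i, Even (e i)) : ∏ i, g i ^ e i = 1 := by
  apply Finset.prod_eq_one
  intro i _
  obtain ⟨k, hk⟩ := he i
  rw [hk, ← two_mul, _root_.zpow_mul]
  have : g i ^ (2 : ℤ) = 1 := by exact_mod_cast hg i
  rw [this, _root_.one_zpow]

lemma lift_even {ι A : Type*} [DecidableEq ι] [Fintype ι] [h : Group A]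
    (hc : ∀ a b : A, a * b = b * a) (g : ι → A) (f : FreeGroup ι)
    (hg : ∀ i, g i ^ 2 = 1) (he : ∀ i, Even (ex f i)) : FreeGroup.lift g f = 1 := by
  let _ : CommGroup A := { h with mul_comm := hc }
  exact (lift_comm g f).trans (prod_even g _ hg he)

/-- The relations. -/
structure Rels {G : Type*} [Group G] (g : ℕ → G) (N : ℕ) : Prop where
  h1 : g 0 ^ 4 = 1
  h2 : ∀ i ≤ N, g 0 ^ 2 = g i ^ 2
  h3 : ∀ i ≤ N, (g 0 * g i) ^ 4 = 1
  h4 : ∀ i d, 1 ≤ d → i + d ≤ N → br (g 0) (g d) = br (g i) (g (i + d))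

lemma rels_gen (N : ℕ) : Rels Hs.gen N where
  h1 := Hs.pow_four _
  h2 i _ := by rw [Hs.gen_sq, Hs.gen_sq]
  h3 i _ := Hs.pow_four _
  h4 i d _ _ := by
    have := Hs.br_gen 0 d
    rw [zero_add] at this
    rw [this, Hs.br_gen]

section
variable {G : Type*} [Group G]

lemma br_eq (a b : G) (hz : a ^ 2 = b ^ 2) (h4 : a ^ 4 = 1) : br a b = (a * b) ^ 2 := by
  have ha : a⁻¹ = a ^ 2 * a := by
    rw [inv_eq_iff_mul_eq_one]; rw [← h4]; group
  have hb : b⁻¹ = b * a ^ 2 := by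
    rw [inv_eq_iff_mul_eq_one, hz, ← h4, show (4 : ℕ) = 2 * 2 from rfl, pow_mul, hz]; group
  have hc : a ^ 2 * b = b * a ^ 2 := by rw [hz]; group
  have h22 : a ^ 2 * a ^ 2 = 1 := by rw [← h4]; group
  calc br a b = (a ^ 2 * a) * (b * a ^ 2) * a * b := by rw [br, ha, hb]
    _ = a * (a ^ 2 * b) * a ^ 2 * (a * b) := by group
    _ = a * b * (a ^ 2 * a ^ 2) * (a * b) := by rw [hc]; group
    _ = (a * b) ^ 2 := by rw [h22, pow_two, mul_one]

lemma sq_swap (a b : G) (hz : a ^ 2 = b ^ 2) (h4 : a ^ 4 = 1) (h : ((a * b) ^ 2) ^ 2 = 1) :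
    (a * b) ^ 2 = (b * a) ^ 2 := by
  have hc : a ^ 2 * b = b * a ^ 2 := by rw [hz]; group
  have h22 : a ^ 2 * a ^ 2 = 1 := by rw [← h4]; group
  have e : (a * b) ^ 2 * (b * a) ^ 2 = 1 := by
    calc (a * b) ^ 2 * (b * a) ^ 2 = a * b * a * (b ^ 2) * a * b * a := by
          simp only [pow_two]; group
      _ = a * b * (a ^ 2 * a ^ 2) * b * a := by rw [← hz]; group
      _ = a * b ^ 2 * a := by rw [h22]; simp only [pow_two, mul_one, mul_assoc]
      _ = 1 := by rw [← hz, ← h4]; group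
  have : (a * b) ^ 2 * (a * b) ^ 2 = 1 := by rw [← pow_two, h]
  exact mul_left_cancel (this.trans e.symm)

lemma comm_left (a b : G) (h : (a * b) ^ 2 = (b * a) ^ 2) : Commute ((a * b) ^ 2) a := by
  show (a * b) ^ 2 * a = a * (a * b) ^ 2
  calc (a * b) ^ 2 * a = a * (b * a) ^ 2 := by simp only [pow_two]; group
    _ = _ := by rw [h]

lemma hall_witt (a b c p q : G) (hp : br a b = p) (hq : br b c = q)
    (hpa : ∀ u ∈ ({a, b, c} : Set G), Commute p u)
    (hqa : ∀ u ∈ ({a, b, c} : Set G), Commute q u) (hpq : Commute p q) :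
    Commute (br a c) b := by
  have h1 : b⁻¹ * a * b = a * p := by rw [← hp, br]; group
  have h2 : b⁻¹ * c * b = c * q⁻¹ := by rw [← hq, br]; group
  have pa := hpa a (by simp)
  have pc := hpa c (by simp)
  have qa := hqa a (by simp)
  have qc := hqa c (by simp)
  have key : b⁻¹ * br a c * b = br a c := by
    calc b⁻¹ * br a c * b
        = (b⁻¹ * a * b)⁻¹ * (b⁻¹ * c * b)⁻¹ * (b⁻¹ * a * b) * (b⁻¹ * c * b) := by
          rw [br]; group
      _ = (a * p)⁻¹ * (c * q⁻¹)⁻¹ * (a * p) * (c * q⁻¹) := by rw [h1, h2]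
      _ = p⁻¹ * a⁻¹ * q * c⁻¹ * (a * p) * c * q⁻¹ := by group
      _ = p⁻¹ * a⁻¹ * q * c⁻¹ * a * (p * c) * q⁻¹ := by group
      _ = p⁻¹ * (a⁻¹ * q) * c⁻¹ * a * c * p * q⁻¹ := by rw [pc.eq]; group
      _ = (p⁻¹ * q) * (a⁻¹ * c⁻¹ * a * c) * (p * q⁻¹) := by
          rw [(qa.symm.inv_left).eq]; group
      _ = (p⁻¹ * q) * ((p * q⁻¹) * (a⁻¹ * c⁻¹ * a * c)) := by
          have P : Commute p (a⁻¹ * c⁻¹ * a * c) :=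
            ((pa.inv_right.mul_right pc.inv_right).mul_right pa).mul_right pc
          have Q : Commute q⁻¹ (a⁻¹ * c⁻¹ * a * c) :=
            (((qa.inv_right.mul_right qc.inv_right).mul_right qa).mul_right qc).inv_left
          rw [mul_assoc (p⁻¹ * q), ((P.mul_left Q).eq)]
      _ = (p⁻¹ * (q * p) * q⁻¹) * (a⁻¹ * c⁻¹ * a * c) := by group
      _ = br a c := by rw [← hpq.eq, br]; group
  show br a c * b = b * br a c
  calc br a c * b = b * (b⁻¹ * br a c * b) := by group
    _ = _ := by rw [key]

lemma Rels.sq_comm {g : ℕ → G} {N : ℕ} (h : Rels g N) (k : ℕ) (hk : k ≤ N) :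
    Commute (g 0 ^ 2) (g k) := by
  rw [h.h2 k hk]
  exact (Commute.refl (g k)).pow_left 2

lemma Rels.br_sq {g : ℕ → G} {N : ℕ} (h : Rels g N) (d : ℕ) (hd : d ≤ N) :
    br (g 0) (g d) ^ 2 = 1 := by
  rw [br_eq _ _ (h.h2 d hd) h.h1, ← pow_mul, h.h3 d hd]

lemma Rels.br_ends {g : ℕ → G} {N : ℕ} (h : Rels g N) (i d : ℕ) (hd : 1 ≤ d) (hi : i + d ≤ N) :
    Commute (br (g 0) (g d)) (g i) ∧ Commute (br (g 0) (g d)) (g (i + d)) := by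
  have hz : g i ^ 2 = g (i + d) ^ 2 := by rw [← h.h2 i (by omega), ← h.h2 (i + d) hi]
  have h4 : g i ^ 4 = 1 := by
    rw [show (4 : ℕ) = 2 * 2 from rfl, pow_mul, ← h.h2 i (by omega), ← pow_mul, h.h1]
  have hs := h.br_sq d (by omega)
  rw [h.h4 i d hd hi] at hs ⊢
  rw [br_eq _ _ hz h4] at hs ⊢
  have sw := sq_swap _ _ hz h4 hs
  refine ⟨comm_left _ _ sw, ?_⟩
  rw [sw]
  exact comm_left _ _ sw.symm

lemma Rels.br_comm {g : ℕ → G} {N : ℕ} (h : Rels g N) (d : ℕ) :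
    1 ≤ d → d ≤ N → ∀ k ≤ N, Commute (br (g 0) (g d)) (g k) := by
  induction d using Nat.strong_induction_on with
  | _ d ih =>
    intro hd hdN k hk
    by_cases hkd : d ≤ k
    · have := (h.br_ends (k - d) d hd (by omega)).2
      rwa [show k - d + d = k by omega] at this
    by_cases hk0 : k = 0
    · subst hk0
      exact (h.br_ends 0 d hd (by omega)).1
    have e2 : br (g k) (g d) = br (g 0) (g (d - k)) := by
      rw [h.h4 k (d - k) (by omega) (by omega), show k + (d - k) = d by omega]
    have c1 := ih k (by omega) (by omega) hk
    have c2 := ih (d - k) (by omega) (by omega) (by omega)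
    refine hall_witt (g 0) (g k) (g d) _ _ rfl e2 ?_ ?_ ?_
    · rintro u (rfl | rfl | rfl)
      · exact c1 0 (by omega)
      · exact c1 k hk
      · exact c1 d hdN
    · rintro u (rfl | rfl | rfl)
      · exact c2 0 (by omega)
      · exact c2 k hk
      · exact c2 d hdN
    · have a := c1 0 (by omega)
      have b := c1 (d - k) (by omega)
      exact ((a.inv_right.mul_right b.inv_right).mul_right a).mul_right b

lemma mem_center_of_gen {S : Set G} (hS : Subgroup.closure S = ⊤) (z : G)
    (hz : ∀ s ∈ S, Commute z s) : z ∈ Subgroup.center G := by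
  have : (⊤ : Subgroup G) ≤ Subgroup.centralizer {z} := by
    rw [← hS, Subgroup.closure_le]
    intro s hs
    rw [SetLike.mem_coe, Subgroup.mem_centralizer_iff]
    rintro _ rfl
    exact (hz s hs).eq
  rw [Subgroup.mem_center_iff]
  intro w
  have hw := this (Subgroup.mem_top w)
  rw [Subgroup.mem_centralizer_iff] at hw
  exact (hw z rfl).symm

lemma comm_of_gen {S : Set G} (hS : Subgroup.closure S = ⊤)
    (h : ∀ s ∈ S, ∀ s' ∈ S, Commute s s') (a b : G) : a * b = b * a := by
  have : (⊤ : Subgroup G) ≤ Subgroup.center G := by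
    rw [← hS, Subgroup.closure_le]
    intro s hs
    exact mem_center_of_gen hS s (h s hs)
  exact (Subgroup.mem_center_iff.1 (this (Subgroup.mem_top b)) a)

/-- The central elements. -/
def gz (g : ℕ → G) (d : ℕ) : G := if d = 0 then g 0 ^ 2 else br (g 0) (g d)

set_option maxHeartbeats 2000000 in
lemma core (N : ℕ) (g : ℕ → G) (hR : Rels g N)
    (hgen : Subgroup.closure (Set.range fun i : Fin (N + 1) => g i) = ⊤)
    (U : G →* Hs) (hU : ∀ i : Fin (N + 1), U (g i) = Hs.gen i) (q : G) (hq : U q = 1) :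
    q = 1 := by
  have hcen : ∀ d : Fin (N + 1), gz g d ∈ Subgroup.center G := by
    intro d
    apply mem_center_of_gen hgen
    rintro _ ⟨k, rfl⟩
    unfold gz
    split_ifs with h0
    · exact hR.sq_comm k (by omega)
    · exact hR.br_comm d (by omega) (by omega) k (by omega)
  have hsq : ∀ d : Fin (N + 1), gz g d ^ 2 = 1 := by
    intro d
    unfold gz
    split_ifs with h0
    · rw [← pow_mul, hR.h1]
    · exact hR.br_sq d (by omega)
  let Z : Subgroup G := Subgroup.closure (Set.range fun d : Fin (N + 1) => gz g d)
  have hZ : Z ≤ Subgroup.center G := by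
    rw [Subgroup.closure_le]; rintro _ ⟨d, rfl⟩; exact hcen d
  have hzm : ∀ d ≤ N, gz g d ∈ Z := fun d hd =>
    Subgroup.subset_closure ⟨⟨d, by omega⟩, rfl⟩
  have : Z.Normal := ⟨fun z hz w => by
    have := Subgroup.mem_center_iff.1 (hZ hz) w
    rw [this, mul_inv_cancel_right]; exact hz⟩
  -- step 1
  have hqZ : q ∈ Z := by
    let π : G →* G ⧸ Z := QuotientGroup.mk' Z
    have hπ : ∀ w, π w = 1 ↔ w ∈ Z := fun w => QuotientGroup.eq_one_iff w
    have hgenA : Subgroup.closure (Set.range fun i : Fin (N + 1) => π (g i)) = ⊤ := by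
      have : (Set.range fun i : Fin (N + 1) => π (g i)) =
          π '' (Set.range fun i : Fin (N + 1) => g i) := by
        rw [← Set.range_comp]; rfl
      rw [this, ← MonoidHom.map_closure, hgen, ← MonoidHom.range_eq_map,
        MonoidHom.range_eq_top]
      exact QuotientGroup.mk'_surjective Z
    have hlt : ∀ i j : ℕ, i < j → j ≤ N → Commute (π (g i)) (π (g j)) := by
      intro i j hij hj
      have h1 : br (g i) (g j) ∈ Z := by
        have := hzm (j - i) (by omega)
        rw [gz, if_neg (by omega), hR.h4 i (j - i) (by omega) (by omega),
          show i + (j - i) = j by omega] at this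
        exact this
      rw [← hπ, br] at h1
      simp only [map_mul, map_inv] at h1
      show π (g i) * π (g j) = π (g j) * π (g i)
      calc π (g i) * π (g j) = π (g j) * π (g i) *
            ((π (g i))⁻¹ * (π (g j))⁻¹ * π (g i) * π (g j)) := by group
        _ = _ := by rw [h1, mul_one]
    have hcomm : ∀ a b : G ⧸ Z, a * b = b * a := by
      apply comm_of_gen hgenA
      rintro _ ⟨i, rfl⟩ _ ⟨j, rfl⟩
      rcases lt_trichotomy (i : ℕ) j with h | h | h
      · exact hlt i j h (by omega)
      · simp only [h]; exact Commute.refl _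
      · exact (hlt j i h (by omega)).symm
    obtain ⟨f, rfl⟩ := (FreeGroup.lift_surjective_iff_closure_range_eq_top.2 hgen) q
    have hev : ∀ j, Even (ex f j) := by
      have h1 : Hs.aHom (U (FreeGroup.lift (fun i : Fin (N + 1) => g i) f)) =
          FreeGroup.lift (fun i : Fin (N + 1) => Multiplicative.ofAdd (T (i : ℕ) : R2)) f := by
        have : (Hs.aHom.comp U).comp (FreeGroup.lift (fun i : Fin (N + 1) => g i)) =
          FreeGroup.lift (fun i : Fin (N + 1) => Multiplicative.ofAdd (T (i : ℕ) : R2)) := by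
          apply FreeGroup.ext_hom
          intro i
          simp only [MonoidHom.comp_apply, FreeGroup.lift_apply_of, hU]
          rfl
        exact DFunLike.congr_fun this f
      rw [hq, map_one, lift_comm] at h1
      have h2 := congrArg Multiplicative.toAdd h1
      simp only [toAdd_one, toAdd_prod, toAdd_zpow, toAdd_ofAdd] at h2
      refine even_of_sum _ _ ?_ h2.symm
      intro i j
      rw [T_apply]
      simp [Fin.ext_iff]
    rw [← hπ]
    have h3 : π (FreeGroup.lift (fun i : Fin (N + 1) => g i) f) =
        FreeGroup.lift (fun i : Fin (N + 1) => π (g i)) f := by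
      have : π.comp (FreeGroup.lift (fun i : Fin (N + 1) => g i)) =
        FreeGroup.lift (fun i : Fin (N + 1) => π (g i)) := by
        apply FreeGroup.ext_hom
        intro i
        simp
      exact DFunLike.congr_fun this f
    rw [h3]
    refine lift_even hcomm _ _ ?_ hev
    intro i
    rw [← map_pow, hπ, ← hR.h2 i (by omega)]
    have := hzm 0 (by omega)
    rwa [gz, if_pos rfl] at this
  -- step 2
  have hq' : q ∈ (FreeGroup.lift (fun d : Fin (N + 1) => gz g d)).range := by
    rw [FreeGroup.range_lift_eq_closure]; exact hqZ
  obtain ⟨f, rfl⟩ := hq'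
  let s : Fin (N + 1) → R2 := fun d => if (d : ℕ) = 0 then 1 else T (d : ℕ) + T (-(d : ℕ))
  have hUz : ∀ d : Fin (N + 1), U (gz g d) =
      Hs.cHom (Multiplicative.ofAdd ((1 + T 1) * s d)) := by
    intro d
    have h0 := hU 0
    simp only [Fin.val_zero] at h0
    simp only [gz, s]
    split_ifs with hd
    · rw [map_pow, h0, Hs.gen_sq, mul_one]
    · have := Hs.br_gen 0 d
      rw [zero_add] at this
      rw [← this, br, br]
      simp only [map_mul, map_inv, h0, hU]
  have hev : ∀ j, Even (ex f j) := by
    have h1 : U (FreeGroup.lift (fun d : Fin (N + 1) => gz g d) f) =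
        Hs.cHom (FreeGroup.lift
          (fun d : Fin (N + 1) => Multiplicative.ofAdd ((1 + T 1) * s d)) f) := by
      have : U.comp (FreeGroup.lift (fun d : Fin (N + 1) => gz g d)) =
        Hs.cHom.comp (FreeGroup.lift
          (fun d : Fin (N + 1) => Multiplicative.ofAdd ((1 + T 1) * s d))) := by
        apply FreeGroup.ext_hom
        intro i
        simp only [MonoidHom.comp_apply, FreeGroup.lift_apply_of, hUz]
      exact DFunLike.congr_fun this f
    rw [hq, lift_comm] at h1
    have h2 : (0 : R2) = ∑ i, ex f i • ((1 + T 1) * s i) := by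
      have := congrArg Hs.c h1
      simpa only [Hs.one_c, Hs.cHom, MonoidHom.coe_mk, OneHom.coe_mk, toAdd_prod, toAdd_zpow,
        toAdd_ofAdd] using this
    simp only [← mul_smul_comm] at h2
    rw [← Finset.mul_sum] at h2
    have h3 := (mul_eq_zero.1 h2.symm).resolve_left one_add_T_ne
    refine even_of_sum _ s ?_ h3
    intro i j
    simp only [s]
    split_ifs with hi hij hij
    · rw [← T_zero, T_apply, if_pos]
      rw [← hij, hi]; rfl
    · rw [← T_zero, T_apply, if_neg]
      rw [Fin.ext_iff] at hij; omega
    · rw [AddMonoidAlgebra.coeff_add, Finsupp.add_apply, T_apply, T_apply, if_pos, if_neg, add_zero]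
      · subst hij; omega
      · rw [hij]
    · rw [Fin.ext_iff] at hij
      rw [AddMonoidAlgebra.coeff_add, Finsupp.add_apply, T_apply, T_apply, if_neg, if_neg, add_zero]
      · omega
      · omega
  have h3 : FreeGroup.lift (fun d : Fin (N + 1) => gz g d) f =
      (FreeGroup.lift (fun d : Fin (N + 1) => (⟨gz g d, hcen d⟩ : Subgroup.center G)) f).val := by
    have : FreeGroup.lift (fun d : Fin (N + 1) => gz g d) = (Subgroup.center G).subtype.comp
      (FreeGroup.lift (fun d : Fin (N + 1) => (⟨gz g d, hcen d⟩ : Subgroup.center G))) := by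
      apply FreeGroup.ext_hom
      intro i
      simp
    exact DFunLike.congr_fun this f
  have h5 : FreeGroup.lift
      (fun d : Fin (N + 1) => (⟨gz g d, hcen d⟩ : Subgroup.center G)) f = 1 :=
    lift_even (fun a b => Subtype.ext (Subgroup.mem_center_iff.1 b.2 a)) _ f
      (fun i => Subtype.ext (hsq i)) hev
  rw [h3, h5]
  rfl

end

/-! ### The presentation -/

/-- Generators of the presented group. -/
def gP (n : ℕ) (i : ℕ) : PresentedGroup (stabRelsA n) :=
  if h : i < n + 2 then PresentedGroup.mk _ (FreeGroup.of ⟨i, h⟩) else 1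

lemma gP_eq (n : ℕ) (i : ℕ) (h : i < n + 2) :
    gP n i = PresentedGroup.mk (stabRelsA n) (FreeGroup.of ⟨i, h⟩) := dif_pos h

lemma map_br {G H : Type*} [Group G] [Group H] (f : G →* H) (a b : G) :
    f (br a b) = br (f a) (f b) := by simp [br]

lemma rels_gP (n : ℕ) : Rels (gP n) (n + 1) where
  h1 := by
    rw [gP_eq n 0 (by omega), ← map_pow]
    exact PresentedGroup.one_of_mem (Or.inl (Or.inl (Or.inl (Or.inl rfl))))
  h2 := by
    rintro (_ | i) hi
    · rfl
    rw [gP_eq n 0 (by omega), gP_eq n (i + 1) (by omega), ← map_pow, ← map_pow]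
    exact PresentedGroup.mk_eq_mk_of_mul_inv_mem
      (Or.inl (Or.inl (Or.inl (Or.inr ⟨i, by omega, rfl⟩))))
  h3 := by
    have e1 : gP n 0 ^ 4 = 1 := by
      rw [gP_eq n 0 (by omega), ← map_pow]
      exact PresentedGroup.one_of_mem (Or.inl (Or.inl (Or.inl (Or.inl rfl))))
    rintro (_ | i) hi
    · rw [← pow_two, ← pow_mul, show 2 * 4 = 4 * 2 from rfl, pow_mul, e1, one_pow]
    rw [gP_eq n 0 (by omega), gP_eq n (i + 1) (by omega), ← map_mul, ← map_pow]
    exact PresentedGroup.one_of_mem (Or.inl (Or.inl (Or.inr ⟨i, by omega, rfl⟩)))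
  h4 := by
    rintro (_ | k) (_ | i) hd hi
    · omega
    · rw [zero_add]
    · omega
    rw [gP_eq n 0 (by omega), gP_eq n (i + 1) (by omega), gP_eq n (k + 1) (by omega),
      gP_eq n (k + 1 + (i + 1)) (by omega), ← map_br, ← map_br]
    refine PresentedGroup.mk_eq_mk_of_mul_inv_mem (Or.inr ⟨i, k + 1, by omega, ?_⟩)
    congr! 5
    omega

lemma rels_ker (n : ℕ) : ∀ r ∈ stabRelsA n, Ulift n r = 1 := by
  have R := rels_gen (n + 1)
  have hof : ∀ (i : ℕ) (h : i < n + 2), Ulift n (FreeGroup.of ⟨i, h⟩) = Hs.gen i := by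
    intro i h; simp [Ulift]
  have hof0 : Ulift n (FreeGroup.of 0) = Hs.gen 0 := hof 0 (by omega)
  rintro r ((((rfl | ⟨i, hi, rfl⟩) | ⟨i, hi, rfl⟩) | ⟨i, j, k, hi, rfl⟩) | ⟨i, k, hi, rfl⟩)
  · rw [map_pow, Hs.pow_four]
  · rw [map_mul, map_inv, map_pow, map_pow, hof0, hof, mul_inv_eq_one]
    exact R.h2 _ (by omega)
  · rw [map_pow, Hs.pow_four]
  · rw [map_mul, map_inv, map_br, map_br, hof, hof, hof, hof, mul_inv_eq_one]
    have a := R.h4 (i + 1) (j - i) (by omega) (by omega)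
    have b := R.h4 (i + k + 1) (j - i) (by omega) (by omega)
    rw [show i + 1 + (j - i) = j + 1 by omega] at a
    rw [show i + k + 1 + (j - i) = j + k + 1 by omega] at b
    rw [← a, ← b]
  · rw [map_mul, map_inv, map_br, map_br, hof0, hof, hof, hof, mul_inv_eq_one]
    have b := R.h4 k (i + 1) (by omega) (by omega)
    rw [b, show k + (i + 1) = i + k + 1 by omega]

lemma ker_U (n : ℕ) : (Ulift n).ker = Subgroup.normalClosure (stabRelsA n) := by
  apply le_antisymm
  · intro f hf
    rw [← PresentedGroup.mk_eq_one_iff]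
    let U : PresentedGroup (stabRelsA n) →* Hs :=
      PresentedGroup.toGroup (f := fun i : Fin (n + 2) => Hs.gen i) (rels_ker n)
    have hUm : ∀ w, U (PresentedGroup.mk _ w) = Ulift n w := fun w => rfl
    refine core (n + 1) (gP n) (rels_gP n) ?_ U ?_ _ ?_
    · rw [← PresentedGroup.closure_range_of]
      congr 1
      congr 1
      funext i
      exact gP_eq n i i.2
    · intro i
      rw [gP_eq n i i.2, hUm]
      simp [Ulift]
    · rw [hUm]; exact hf
  · exact Subgroup.normalClosure_le_normal (rels_ker n)

/-- **Theorem A.1.** `Stab(7^{(n)})` is presented by the generators `x, a₀, …, a_n` and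
the relations `1_a)–5_a)`: the evaluation homomorphism is onto `Stab(7^{(n)})` and its
kernel is the normal closure of the relators. -/
theorem statement10 (n : ℕ) :
    (φStabA n).range = Stab n ∧
      (φStabA n).ker = Subgroup.normalClosure (stabRelsA n) := by
  exact ⟨range_eq n, (ker_eq n).trans (ker_U n)⟩
end
end

section
/- For each nonnegative integer n, the center of P_n equals the subgroup generated by x², b₁², …, b_{n+1}²; this center is elementary abelian of order 2^{n+2} (isomorphic to (ℤ/2ℤ)^{n+2}), and the quotient of P_n by its center is also elementary abelian of order 2^{n+2}. In particular, g² lies in the center of P_n for every g ∈ P_n, and g⁴ = 1 for every g ∈ P_n. -/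
noncomputable section

/-- The relators of `P_n`: `x⁴ = 1`, `b_i⁴ = 1` and `[x,b_i] = b_i²` for `1 ≤ i ≤ n+1`,
and `[b_i,b_j] = b_i²·b_{j-i}²·b_j²` for `1 ≤ i < j ≤ n+1`. Here generator `0` is `x`
and generator `i` is `b_i` for `1 ≤ i ≤ n+1`. -/
def pnRels (n : ℕ) : Set (FreeGroup (Fin (n + 2))) :=
  {(FreeGroup.of (0 : Fin (n + 2))) ^ 4} ∪
    {r | ∃ i : ℕ, ∃ _ : 1 ≤ i ∧ i ≤ n + 1, r =
      (FreeGroup.of (⟨i, by omega⟩ : Fin (n + 2))) ^ 4} ∪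
    {r | ∃ i : ℕ, ∃ _ : 1 ≤ i ∧ i ≤ n + 1, r =
      br (FreeGroup.of (0 : Fin (n + 2))) (FreeGroup.of (⟨i, by omega⟩ : Fin (n + 2))) *
        ((FreeGroup.of (⟨i, by omega⟩ : Fin (n + 2))) ^ 2)⁻¹} ∪
    {r | ∃ i j : ℕ, ∃ _ : 1 ≤ i ∧ i < j ∧ j ≤ n + 1, r =
      br (FreeGroup.of (⟨i, by omega⟩ : Fin (n + 2)))
          (FreeGroup.of (⟨j, by omega⟩ : Fin (n + 2))) *
        ((FreeGroup.of (⟨i, by omega⟩ : Fin (n + 2))) ^ 2 *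
          (FreeGroup.of (⟨j - i, by omega⟩ : Fin (n + 2))) ^ 2 *
          (FreeGroup.of (⟨j, by omega⟩ : Fin (n + 2))) ^ 2)⁻¹}

/-- The group `P_n`, presented on generators `x, b₁, …, b_{n+1}` with the relations
`1_b)–3_b)` (isomorphic to `Stab(7^{(n)})`). -/
abbrev Pn (n : ℕ) : Type := PresentedGroup (pnRels n)

/-- The generator `x` of `P_n`. -/
def pnx (n : ℕ) : Pn n := PresentedGroup.of 0

/-- The set `{x², b₁², …, b_{n+1}²}` in `P_n`. -/
def pnSq (n : ℕ) : Set (Pn n) :=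
  {pnx n ^ 2} ∪
    {g | ∃ i : ℕ, ∃ _ : 1 ≤ i ∧ i ≤ n + 1, g =
      (PresentedGroup.of (⟨i, by omega⟩ : Fin (n + 2)) : Pn n) ^ 2}

/-- The set `{b₁², …, b_{n+1}²}` in `P_n`. -/
def pnSqB (n : ℕ) : Set (Pn n) :=
  {g | ∃ i : ℕ, ∃ _ : 1 ≤ i ∧ i ≤ n + 1, g =
    (PresentedGroup.of (⟨i, by omega⟩ : Fin (n + 2)) : Pn n) ^ 2}

/-- Vectors over `F₂`. -/
abbrev VV (n : ℕ) := Fin (n + 2) → ZMod 2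

/-- Basis vectors. -/
def ee (n : ℕ) (i : Fin (n + 2)) : VV n := Pi.single i 1

/-- Structure constants. -/
def BB (n : ℕ) (i j : Fin (n + 2)) : VV n :=
  if i = j then ee n i else if i < j then
    (if i = 0 then ee n j else ee n i + ee n ⟨j.val - i.val, by omega⟩ + ee n j) else 0

/-- The bilinear cocycle. -/
def bet (n : ℕ) (v w : VV n) : VV n := ∑ i, ∑ j, (v i * w j) • BB n i j

lemma bet_add_left (n : ℕ) (u v w : VV n) : bet n (u + v) w = bet n u w + bet n v w := by
  simp [bet, add_mul, add_smul, Finset.sum_add_distrib]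

lemma bet_add_right (n : ℕ) (u v w : VV n) : bet n u (v + w) = bet n u v + bet n u w := by
  simp [bet, mul_add, add_smul, Finset.sum_add_distrib]

lemma bet_zero_left (n : ℕ) (w : VV n) : bet n 0 w = 0 := by
  simp [bet]

lemma bet_zero_right (n : ℕ) (w : VV n) : bet n w 0 = 0 := by
  simp [bet]

lemma bet_right (n : ℕ) (v : VV n) (j) : bet n v (ee n j) = ∑ i, v i • BB n i j := by
  simp [bet, ee, Pi.single_apply]

lemma bet_left (n : ℕ) (v : VV n) (i) : bet n (ee n i) v = ∑ j, v j • BB n i j := by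
  simp [bet, ee, Pi.single_apply, ite_mul, Finset.sum_ite_irrel]

lemma bet_ee (n : ℕ) (i j) : bet n (ee n i) (ee n j) = BB n i j := by
  rw [bet_left]; simp [ee, Pi.single_apply]

lemma vv_add_self {n : ℕ} (v : VV n) : v + v = 0 := by
  ext i; exact CharTwo.add_self_eq_zero (v i)

lemma vv_neg {n : ℕ} (v : VV n) : -v = v := by
  ext i; exact CharTwo.neg_eq (v i)

/-- The model group. -/
@[ext] structure MM (n : ℕ) where
  /-- quotient part -/
  p : VV n
  /-- central part -/
  q : VV n

instance (n : ℕ) : Mul (MM n) := ⟨fun a b => ⟨a.p + b.p, a.q + b.q + bet n a.p b.p⟩⟩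
instance (n : ℕ) : One (MM n) := ⟨⟨0, 0⟩⟩
instance (n : ℕ) : Inv (MM n) := ⟨fun a => ⟨a.p, a.q + bet n a.p a.p⟩⟩

@[simp] lemma MM.mul_p {n : ℕ} (a b : MM n) : (a * b).p = a.p + b.p := rfl
@[simp] lemma MM.mul_q {n : ℕ} (a b : MM n) : (a * b).q = a.q + b.q + bet n a.p b.p := rfl
@[simp] lemma MM.one_p {n : ℕ} : (1 : MM n).p = 0 := rfl
@[simp] lemma MM.one_q {n : ℕ} : (1 : MM n).q = 0 := rfl
@[simp] lemma MM.inv_p {n : ℕ} (a : MM n) : (a⁻¹).p = a.p := rfl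
@[simp] lemma MM.inv_q {n : ℕ} (a : MM n) : (a⁻¹).q = a.q + bet n a.p a.p := rfl

instance (n : ℕ) : Group (MM n) := Group.ofLeftAxioms
  (by
    intro a b c
    ext1
    · simp [add_assoc]
    · simp only [MM.mul_q, MM.mul_p, bet_add_left, bet_add_right]; abel)
  (by intro a; ext1 <;> simp [bet_zero_left])
  (by
    intro a
    ext1
    · simp [vv_add_self]
    · simp only [MM.mul_q, MM.inv_q, MM.inv_p, MM.one_q]
      rw [show a.q + bet n a.p a.p + a.q + bet n a.p a.p
        = (a.q + bet n a.p a.p) + (a.q + bet n a.p a.p) by abel, vv_add_self])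

/-- Generators of the model. -/
def mg (n : ℕ) (i : Fin (n + 2)) : MM n := ⟨ee n i, 0⟩

lemma mg_sq (n : ℕ) (i) : mg n i ^ 2 = ⟨0, ee n i⟩ := by
  rw [pow_two]; ext1
  · simp [mg, vv_add_self]
  · simp [mg, bet_ee, BB]

lemma mcentral_mul {n : ℕ} (u v : VV n) : (⟨0, u⟩ * ⟨0, v⟩ : MM n) = ⟨0, u + v⟩ := by
  ext1 <;> simp [bet_zero_left]

lemma mg_four (n : ℕ) (i) : mg n i ^ 4 = 1 := by
  rw [show 4 = 2 * 2 from rfl, pow_mul, mg_sq, pow_two, mcentral_mul, vv_add_self]; rfl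

lemma br_eq_s12 {G : Type*} [Group G] {a b c : G} : br a b * c⁻¹ = 1 ↔ a * b = b * a * c := by
  unfold br
  rw [mul_inv_eq_one]
  constructor
  · rintro rfl; group
  · intro h
    rw [show a⁻¹ * b⁻¹ * a * b = a⁻¹ * b⁻¹ * (a * b) by group, h]; group

lemma mg_comm (n : ℕ) (i j : Fin (n + 2)) (h : i < j) (u : VV n) (hu : BB n i j = u) :
    mg n i * mg n j = mg n j * mg n i * ⟨0, u⟩ := by
  ext1
  · simp [mg, add_comm]
  · have : BB n j i = 0 := by simp [BB, h.ne', h.le]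
    simp [mg, bet_ee, this, bet_zero_right, hu]

lemma rels_ok (n : ℕ) : ∀ r ∈ pnRels n, FreeGroup.lift (mg n) r = 1 := by
  rintro r (((rfl | ⟨i, hi, rfl⟩) | ⟨i, hi, rfl⟩) | ⟨i, j, hi, rfl⟩)
  · simp [mg_four]
  · simp [mg_four]
  · have h : (0 : Fin (n + 2)) < ⟨i, by omega⟩ := by rw [Fin.lt_def]; simp; omega
    have := br_eq_s12.2 (mg_comm n 0 ⟨i, by omega⟩ h _ rfl)
    simp only [br, map_mul, map_inv, map_pow, FreeGroup.lift_apply_of, mg_sq] at this ⊢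
    rw [← this]; simp [BB, h, h.ne]
  · have h : (⟨i, by omega⟩ : Fin (n + 2)) < ⟨j, by omega⟩ := by rw [Fin.lt_def]; simp; omega
    have h0 : (⟨i, by omega⟩ : Fin (n + 2)) ≠ 0 := by
      intro h; rw [Fin.ext_iff] at h; simp at h; omega
    have := br_eq_s12.2 (mg_comm n ⟨i, by omega⟩ ⟨j, by omega⟩ h _ rfl)
    simp only [br, map_mul, map_inv, map_pow, FreeGroup.lift_apply_of, mg_sq,
      mcentral_mul] at this ⊢
    rw [← this]; simp only [BB, h, h.ne, h0, if_true, if_false]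

/-- The map to the model. -/
def phi (n : ℕ) : Pn n →* MM n := PresentedGroup.toGroup (rels_ok n)

/-- Generators. -/
def gg (n : ℕ) (i : Fin (n + 2)) : Pn n := PresentedGroup.of i

lemma phi_gg (n i) : phi n (gg n i) = mg n i := PresentedGroup.toGroup.of _

/-- The projection. -/
def ppi (n : ℕ) : Pn n →* Multiplicative (VV n) :=
  MonoidHom.comp ⟨⟨fun a => Multiplicative.ofAdd a.p, rfl⟩, fun _ _ => rfl⟩ (phi n)

lemma ppi_apply (n g) : ppi n g = Multiplicative.ofAdd (phi n g).p := rfl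

lemma ppi_gg (n i) : ppi n (gg n i) = Multiplicative.ofAdd (ee n i) := by
  rw [ppi_apply, phi_gg]; rfl

/-! Relations in `P_n`. -/

lemma gg_four (n i) : gg n i ^ 4 = 1 := by
  apply (PresentedGroup.one_of_mem (rels := pnRels n) (x := FreeGroup.of i ^ 4))
  rcases Nat.eq_zero_or_pos i.val with h | h
  · have : i = 0 := Fin.ext h
    subst this; exact Or.inl (Or.inl (Or.inl rfl))
  · exact Or.inl (Or.inl (Or.inr ⟨i.val, ⟨h, by omega⟩, rfl⟩))

lemma gg_zero (n) (i : Fin (n + 2)) (h : 0 < i.val) :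
    gg n 0 * gg n i = gg n i * gg n 0 * gg n i ^ 2 := by
  rw [← br_eq_s12]
  exact PresentedGroup.one_of_mem (rels := pnRels n) (Or.inl (Or.inr ⟨i.val, ⟨h, by omega⟩, rfl⟩))

lemma gg_comm (n) (i j : Fin (n + 2)) (h : 0 < i.val) (hij : i.val < j.val) :
    gg n i * gg n j = gg n j * gg n i *
      (gg n i ^ 2 * gg n ⟨j.val - i.val, by omega⟩ ^ 2 * gg n j ^ 2) := by
  rw [← br_eq_s12]
  exact PresentedGroup.one_of_mem (rels := pnRels n)
    (Or.inr ⟨i.val, j.val, ⟨h, hij, by omega⟩, rfl⟩)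

/-- If `a b = b a b²` and `b⁴ = 1`, squares commute. -/
lemma inv_comm_aux {G : Type*} [Group G] {a b : G} (hb : b ^ 4 = 1)
    (h : a * b = b * a * b ^ 2) : Commute (a ^ 2) b ∧ Commute a (b ^ 2) := by
  have h1 : a⁻¹ * b * a = b⁻¹ := by
    have : a⁻¹ * b⁻¹ * a = b := by
      have : a⁻¹ * b⁻¹ * (a * b) = b ^ 2 := by rw [h]; group
      calc a⁻¹ * b⁻¹ * a = a⁻¹ * b⁻¹ * (a * b) * b⁻¹ := by group
        _ = b := by rw [this]; group
    calc a⁻¹ * b * a = (a⁻¹ * b⁻¹ * a)⁻¹ := by group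
      _ = b⁻¹ := by rw [this]
  constructor
  · have : (a ^ 2)⁻¹ * b * a ^ 2 = b := by
      calc (a ^ 2)⁻¹ * b * a ^ 2 = a⁻¹ * (a⁻¹ * b * a) * a := by rw [pow_two]; group
        _ = (a⁻¹ * b * a)⁻¹ := by rw [h1]; nth_rewrite 2 [← h1]; group
        _ = b := by rw [h1]; group
    calc a ^ 2 * b = a ^ 2 * ((a ^ 2)⁻¹ * b * a ^ 2) := by rw [this]
      _ = b * a ^ 2 := by group
  · have h2 : a⁻¹ * b ^ 2 * a = b ^ 2 := by
      calc a⁻¹ * b ^ 2 * a = (a⁻¹ * b * a) * (a⁻¹ * b * a) := by rw [pow_two]; group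
        _ = b ^ 2 * (b ^ 4)⁻¹ := by rw [h1]; group
        _ = b ^ 2 := by rw [hb]; group
    calc a * b ^ 2 = a * (a⁻¹ * b ^ 2 * a) * 1 := by rw [h2]; nth_rewrite 1 [← h2]; rw [h2]; group
      _ = b ^ 2 * a := by group

/-- Main step. -/
lemma step_aux {G : Type*} [Group G] {a b d : G} (ha : a ^ 4 = 1) (hd : d ^ 4 = 1)
    (hb : b ^ 4 = 1) (had : Commute (a ^ 2) d) (had' : Commute a (d ^ 2))
    (h : a * b = b * a * (a ^ 2 * d ^ 2 * b ^ 2))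
    (h' : d * b = b * d * (d ^ 2 * a ^ 2 * b ^ 2)) :
    Commute (a ^ 2) b ∧ Commute a (b ^ 2) := by
  have hc : d ^ 2 * a ^ 2 = a ^ 2 * d ^ 2 := (had'.pow_left 2).eq.symm
  rw [hc] at h'
  obtain ⟨z, hz⟩ : ∃ z, z = a ^ 2 * d ^ 2 := ⟨_, rfl⟩
  rw [← hz] at h h'
  have hzz : z * z = 1 := by
    calc z * z = a ^ 2 * (d ^ 2 * a ^ 2) * d ^ 2 := by rw [hz]; group
      _ = a ^ 4 * d ^ 4 := by rw [hc]; group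
      _ = 1 := by rw [ha, hd]; group
  have hzi : z⁻¹ = z := inv_eq_of_mul_eq_one_left hzz
  have hza : Commute a z := by
    rw [hz]; exact ((Commute.refl a).pow_right 2).mul_right had'
  have hzd : Commute d z := by
    rw [hz]; exact had.symm.mul_right ((Commute.refl d).pow_right 2)
  have key : ∀ t : G, Commute t z → t * b = b * t * (z * b ^ 2) →
      t⁻¹ * b * t = b⁻¹ * z ∧ (t ^ 2)⁻¹ * b * t ^ 2 = z * b * z := by
    intro t htz ht
    have e1 : t⁻¹ * b⁻¹ * t = z * b := by
      have : t⁻¹ * b⁻¹ * (t * b) = z * b ^ 2 := by rw [ht]; group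
      calc t⁻¹ * b⁻¹ * t = t⁻¹ * b⁻¹ * (t * b) * b⁻¹ := by group
        _ = z * b := by rw [this]; group
    have e2 : t⁻¹ * b * t = b⁻¹ * z := by
      calc t⁻¹ * b * t = (t⁻¹ * b⁻¹ * t)⁻¹ := by group
        _ = b⁻¹ * z := by rw [e1, mul_inv_rev, hzi]
    have e3 : t⁻¹ * z * t = z := by
      rw [mul_assoc, ← htz.eq]; group
    refine ⟨e2, ?_⟩
    calc (t ^ 2)⁻¹ * b * t ^ 2 = t⁻¹ * (t⁻¹ * b * t) * t := by rw [pow_two]; group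
      _ = (t⁻¹ * b⁻¹ * t) * (t⁻¹ * z * t) := by rw [e2]; group
      _ = z * b * z := by rw [e1, e3]
  obtain ⟨a1, a2⟩ := key a hza h
  obtain ⟨d1, d2⟩ := key d hzd h'
  have hz2 : (d ^ 2)⁻¹ * z * d ^ 2 = z := by
    rw [mul_assoc, ← (hzd.pow_left 2).eq]; group
  have hzb : z⁻¹ * b * z = b := by
    calc z⁻¹ * b * z = (d ^ 2)⁻¹ * ((a ^ 2)⁻¹ * b * a ^ 2) * d ^ 2 := by rw [hz]; group
      _ = ((d ^ 2)⁻¹ * z * d ^ 2) * ((d ^ 2)⁻¹ * b * d ^ 2) * ((d ^ 2)⁻¹ * z * d ^ 2) := by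
        rw [a2]; group
      _ = (z * z) * b * (z * z) := by rw [hz2, d2]; group
      _ = b := by rw [hzz]; group
  rw [hzi] at hzb
  have hcb : Commute z b := by
    calc z * b = (z * b * z) * z⁻¹ := by group
      _ = b * z := by rw [hzb, hzi]
  constructor
  · rw [hzb] at a2
    calc a ^ 2 * b = a ^ 2 * ((a ^ 2)⁻¹ * b * a ^ 2) := by rw [a2]
      _ = b * a ^ 2 := by group
  · have h2 : a⁻¹ * b ^ 2 * a = b ^ 2 := by
      calc a⁻¹ * b ^ 2 * a = (a⁻¹ * b * a) * (a⁻¹ * b * a) := by rw [pow_two]; group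
        _ = b⁻¹ * (z * b⁻¹) * z := by rw [a1]; group
        _ = b⁻¹ * b⁻¹ * (z * z) := by rw [hcb.inv_right.eq]; group
        _ = b ^ 2 * (b ^ 4)⁻¹ := by rw [hzz]; group
        _ = b ^ 2 := by rw [hb]; group
    calc a * b ^ 2 = a * (a⁻¹ * b ^ 2 * a) := by rw [h2]
      _ = b ^ 2 * a := by group

lemma sq_comm_lt (n : ℕ) : ∀ N : ℕ, ∀ i j : Fin (n + 2), j.val = N → i.val < j.val →
    Commute (gg n i ^ 2) (gg n j) ∧ Commute (gg n i) (gg n j ^ 2) := by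
  intro N
  induction N using Nat.strong_induction_on with
  | _ N ih =>
  intro i j hj hij
  rcases Nat.eq_zero_or_pos i.val with h0 | h0
  · have : i = 0 := Fin.ext h0
    subst this
    exact inv_comm_aux (gg_four n j) (gg_zero n j (by omega))
  · have h := gg_comm n i j h0 hij
    obtain ⟨d, hd⟩ : ∃ d : Fin (n + 2), d = ⟨j.val - i.val, by omega⟩ := ⟨_, rfl⟩
    have hdv : d.val = j.val - i.val := by rw [hd]
    have h' := gg_comm n d j (by omega) (by omega)
    rw [← hd] at h
    rw [show (⟨j.val - d.val, by omega⟩ : Fin (n + 2)) = i from Fin.ext (by simp; omega)] at h'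
    have had : Commute (gg n i ^ 2) (gg n d) ∧ Commute (gg n i) (gg n d ^ 2) := by
      rcases lt_trichotomy i.val d.val with hl | hl | hl
      · exact ih d.val (by omega) i d rfl hl
      · rw [← Fin.ext hl]
        exact ⟨(Commute.refl _).pow_left 2, (Commute.refl _).pow_right 2⟩
      · have := ih i.val (by omega) d i rfl hl
        exact ⟨this.2.symm, this.1.symm⟩
    exact step_aux (gg_four n i) (gg_four n d) (gg_four n j) had.1 had.2 h h'

lemma sq_comm (n : ℕ) (i j : Fin (n + 2)) : Commute (gg n i ^ 2) (gg n j) := by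
  rcases lt_trichotomy i.val j.val with hl | hl | hl
  · exact (sq_comm_lt n _ i j rfl hl).1
  · rw [← Fin.ext hl]; exact (Commute.refl _).pow_left 2
  · exact (sq_comm_lt n _ j i rfl hl).2.symm

lemma closure_gg (n : ℕ) : Subgroup.closure (Set.range (gg n)) = ⊤ :=
  PresentedGroup.closure_range_of _

lemma mem_center_of (n : ℕ) (z : Pn n) (h : ∀ j, Commute z (gg n j)) :
    z ∈ Subgroup.center (Pn n) := by
  have : (⊤ : Subgroup (Pn n)) ≤ Subgroup.centralizer {z} := by
    rw [← closure_gg, Subgroup.closure_le]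
    rintro _ ⟨j, rfl⟩
    rw [SetLike.mem_coe, Subgroup.mem_centralizer_singleton_iff]
    exact (h j).symm.eq
  rw [Subgroup.mem_center_iff]
  intro g
  exact Subgroup.mem_centralizer_singleton_iff.1 (this (Subgroup.mem_top g))

lemma sq_central (n : ℕ) (i) : gg n i ^ 2 ∈ Subgroup.center (Pn n) :=
  mem_center_of n _ (sq_comm n i)

lemma pnSq_eq (n : ℕ) : pnSq n = Set.range (fun i => gg n i ^ 2) := by
  ext g
  constructor
  · rintro (rfl | ⟨i, hi, rfl⟩)
    · exact ⟨0, rfl⟩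
    · exact ⟨⟨i, by omega⟩, rfl⟩
  · rintro ⟨i, rfl⟩
    rcases Nat.eq_zero_or_pos i.val with h | h
    · have : i = 0 := Fin.ext h
      subst this; exact Or.inl rfl
    · exact Or.inr ⟨i.val, ⟨h, by omega⟩, rfl⟩

lemma S_le (n : ℕ) : Subgroup.closure (pnSq n) ≤ Subgroup.center (Pn n) := by
  rw [pnSq_eq, Subgroup.closure_le]
  rintro _ ⟨i, rfl⟩
  exact sq_central n i

lemma sq_mem (n : ℕ) (i) : gg n i ^ 2 ∈ Subgroup.closure (pnSq n) := by
  rw [pnSq_eq]; exact Subgroup.subset_closure ⟨i, rfl⟩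

/-! Homs out of elementary abelian groups. -/

lemma exists_lift {n : ℕ} {A : Type*} [CommGroup A] (a : Fin (n + 2) → A)
    (ha : ∀ i, a i ^ 2 = 1) :
    ∃ f : Multiplicative (VV n) →* A, ∀ i, f (Multiplicative.ofAdd (ee n i)) = a i := by
  refine ⟨⟨⟨fun v => ∏ i, a i ^ (v.toAdd i).val, by simp⟩, ?_⟩, ?_⟩
  · intro v w
    simp only [← Finset.prod_mul_distrib]
    refine Finset.prod_congr rfl fun i _ => ?_
    rw [← pow_add, toAdd_mul, Pi.add_apply, ZMod.val_add]
    exact (pow_eq_pow_mod _ (ha i)).symm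
  · intro i
    change ∏ k, a k ^ (ee n i k).val = a i
    rw [Finset.prod_eq_single i]
    · simp [ee, ZMod.val_one]
    · intro b _ hb; simp [ee, hb]
    · simp

lemma vv_closure (n : ℕ) (H : Subgroup (Multiplicative (VV n)))
    (h : ∀ i, Multiplicative.ofAdd (ee n i) ∈ H) : H = ⊤ := by
  rw [eq_top_iff]
  intro v _
  have : v = ∏ i, (Multiplicative.ofAdd (ee n i)) ^ (v.toAdd i).val := by
    apply Multiplicative.toAdd.injective
    rw [toAdd_prod]
    ext k
    rw [Finset.sum_apply, Finset.sum_eq_single k]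
    · rw [toAdd_pow, Pi.smul_apply, toAdd_ofAdd, ee, Pi.single_eq_same, nsmul_one,
        ZMod.natCast_zmod_val]
    · intro b _ hb
      rw [toAdd_pow, Pi.smul_apply, toAdd_ofAdd, ee, Pi.single_eq_of_ne hb.symm, smul_zero]
    · simp
  rw [this]
  exact Subgroup.prod_mem _ fun i _ => Subgroup.pow_mem _ (h i) _

lemma ppi_surj (n : ℕ) : Function.Surjective (ppi n) := by
  rw [← MonoidHom.range_eq_top]
  exact vv_closure n _ fun i => ⟨gg n i, ppi_gg n i⟩

lemma br_lt_mem (n : ℕ) (i j : Fin (n + 2)) (h : i.val < j.val) :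
    ∃ c ∈ Subgroup.closure (pnSq n), gg n i * gg n j = gg n j * gg n i * c := by
  rcases Nat.eq_zero_or_pos i.val with h0 | h0
  · have : i = 0 := Fin.ext h0
    subst this
    exact ⟨_, sq_mem n j, gg_zero n j h⟩
  · exact ⟨_, mul_mem (mul_mem (sq_mem n _) (sq_mem n _)) (sq_mem n _), gg_comm n i j h0 h⟩

lemma ker_le (n : ℕ) : (ppi n).ker ≤ Subgroup.closure (pnSq n) := by
  have hN : (Subgroup.closure (pnSq n)).Normal := by
    constructor
    intro s hs g
    rw [(Subgroup.mem_center_iff.1 (S_le n hs) g), mul_inv_cancel_right]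
    exact hs
  obtain ⟨S, hS⟩ : ∃ S, S = Subgroup.closure (pnSq n) := ⟨_, rfl⟩
  have hlt := br_lt_mem n
  have hsq := sq_mem n
  rw [← hS] at hN hlt hsq ⊢
  let q : Pn n →* Pn n ⧸ S := QuotientGroup.mk' S
  have hq1 : ∀ s ∈ S, q s = 1 := fun s hs => (QuotientGroup.eq_one_iff s).2 hs
  have hqlt : ∀ i j : Fin (n + 2), i.val < j.val →
      q (gg n i) * q (gg n j) = q (gg n j) * q (gg n i) := by
    intro i j hij
    obtain ⟨c, hc, e⟩ := hlt i j hij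
    rw [← map_mul, e, map_mul, hq1 c hc, mul_one, map_mul]
  have hqg : ∀ i j : Fin (n + 2), q (gg n i) * q (gg n j) = q (gg n j) * q (gg n i) := by
    intro i j
    rcases lt_trichotomy i.val j.val with hl | hl | hl
    · exact hqlt i j hl
    · rw [Fin.ext hl]
    · exact (hqlt j i hl).symm
  have hq2 : ∀ (i) (g : Pn n), q (gg n i) * q g = q g * q (gg n i) := by
    intro i g
    have : (⊤ : Subgroup (Pn n)) ≤ (Subgroup.centralizer {q (gg n i)}).comap q := by
      rw [← closure_gg, Subgroup.closure_le]
      rintro _ ⟨j, rfl⟩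
      rw [SetLike.mem_coe, Subgroup.mem_comap, Subgroup.mem_centralizer_singleton_iff]
      exact hqg j i
    exact (Subgroup.mem_centralizer_singleton_iff.1 (this (Subgroup.mem_top g))).symm
  have hq3 : ∀ (h g : Pn n), q h * q g = q g * q h := by
    intro h g
    have : (⊤ : Subgroup (Pn n)) ≤ (Subgroup.centralizer {q g}).comap q := by
      rw [← closure_gg, Subgroup.closure_le]
      rintro _ ⟨j, rfl⟩
      rw [SetLike.mem_coe, Subgroup.mem_comap, Subgroup.mem_centralizer_singleton_iff]
      exact hq2 j g
    exact Subgroup.mem_centralizer_singleton_iff.1 (this (Subgroup.mem_top h))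
  let _ : CommGroup (Pn n ⧸ S) :=
    { (inferInstance : Group (Pn n ⧸ S)) with
      mul_comm := by
        intro a b
        obtain ⟨a, rfl⟩ := QuotientGroup.mk'_surjective S a
        obtain ⟨b, rfl⟩ := QuotientGroup.mk'_surjective S b
        exact hq3 a b }
  obtain ⟨f, hf⟩ := exists_lift (fun i => q (gg n i)) (by
    intro i
    rw [← map_pow]; exact hq1 _ (hsq i))
  have hfe : f.comp (ppi n) = q := by
    refine PresentedGroup.ext ?_
    intro i
    change f (ppi n (gg n i)) = q (gg n i)
    rw [ppi_gg, hf]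
  intro g hg
  rw [MonoidHom.mem_ker] at hg
  have : q g = 1 := by rw [← hfe, MonoidHom.comp_apply, hg, map_one]
  exact (QuotientGroup.eq_one_iff g).1 this

lemma center_le_ker (n : ℕ) : Subgroup.center (Pn n) ≤ (ppi n).ker := by
  intro g hg
  have hcomm : ∀ j, bet n (phi n g).p (ee n j) = bet n (ee n j) (phi n g).p := by
    intro j
    have h1 := congrArg (phi n) (Subgroup.mem_center_iff.1 hg (gg n j))
    rw [map_mul, map_mul, phi_gg] at h1
    have h2 := congrArg MM.q h1
    simp only [MM.mul_q, mg, zero_add, add_zero] at h2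
    exact (add_left_cancel h2).symm
  rw [MonoidHom.mem_ker, ppi_apply]
  obtain ⟨v, hv⟩ : ∃ v, v = (phi n g).p := ⟨_, rfl⟩
  rw [← hv] at hcomm ⊢
  simp only [bet_right, bet_left] at hcomm
  have hpos : ∀ k : Fin (n + 2), k ≠ 0 → v k = 0 := by
    intro k hk
    have h := congrFun (hcomm 0) k
    simp only [Finset.sum_apply, Pi.smul_apply, smul_eq_mul] at h
    rw [Finset.sum_eq_zero, Finset.sum_eq_single k] at h
    · simpa [BB, hk.symm, Fin.pos_iff_ne_zero.2 hk, ee] using h.symm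
    · intro i _ hi
      by_cases h0 : i = 0
      · subst h0; simp [BB, ee, hk]
      · simp [BB, Ne.symm h0, Fin.pos_iff_ne_zero.2 h0, ee, hi.symm]
    · simp
    · intro i _
      by_cases h0 : i = 0
      · subst h0; simp [BB, ee, hk]
      · simp [BB, h0]
  have h0 : v 0 = 0 := by
    have h := congrFun (hcomm 1) 1
    simp only [Finset.sum_apply, Pi.smul_apply, smul_eq_mul] at h
    rw [Finset.sum_eq_single 0, Finset.sum_eq_single 0] at h
    · simpa [BB, ee] using h
    · intro i _ hi; rw [hpos i hi, zero_mul]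
    · simp
    · intro i _ hi; rw [hpos i hi, zero_mul]
    · simp
  have : v = 0 := by
    ext k
    by_cases hk : k = 0
    · rw [hk, h0]; rfl
    · rw [hpos k hk]; rfl
  rw [this]; rfl

lemma center_eq (n : ℕ) : Subgroup.center (Pn n) = Subgroup.closure (pnSq n) :=
  le_antisymm ((center_le_ker n).trans (ker_le n)) (S_le n)

lemma ker_eq_s12 (n : ℕ) : (ppi n).ker = Subgroup.center (Pn n) :=
  le_antisymm ((ker_le n).trans (S_le n)) (center_le_ker n)

lemma theta_ex (n : ℕ) : ∃ f : Multiplicative (VV n) →* Subgroup.center (Pn n),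
    Function.Bijective f := by
  let _ : CommGroup (Subgroup.center (Pn n)) :=
    { (inferInstance : Group (Subgroup.center (Pn n))) with
      mul_comm := fun a b => Subtype.ext (Subgroup.mem_center_iff.1 b.2 a.1) }
  obtain ⟨f, hf⟩ := exists_lift (n := n) (A := Subgroup.center (Pn n))
    (fun i => ⟨gg n i ^ 2, sq_central n i⟩) (by
      intro i
      apply Subtype.ext
      change (gg n i ^ 2) ^ 2 = 1
      rw [← pow_mul]; exact gg_four n i)
  refine ⟨f, ?_, ?_⟩
  · let inc : Multiplicative (VV n) →* MM n :=
      ⟨⟨fun w => ⟨0, w.toAdd⟩, rfl⟩, fun u v => (mcentral_mul u.toAdd v.toAdd).symm⟩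
    have key : ((phi n).comp ((Subgroup.center (Pn n)).subtype.comp f)).eqLocus inc = ⊤ := by
      apply vv_closure
      intro i
      change phi n (f (Multiplicative.ofAdd (ee n i))) = ⟨0, ee n i⟩
      rw [hf]
      change phi n (gg n i ^ 2) = _
      rw [map_pow, phi_gg, mg_sq]
    intro u v huv
    have e : ∀ u, phi n (f u) = inc u := by
      intro u
      have hu := Subgroup.mem_top u
      rw [← key] at hu
      exact hu
    have : inc u = inc v := by rw [← e, ← e, huv]
    exact congrArg MM.q this
  · rintro ⟨z, hz⟩
    have : Subgroup.closure (pnSq n) ≤ ((Subgroup.center (Pn n)).subtype.comp f).range := by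
      rw [pnSq_eq, Subgroup.closure_le]
      rintro _ ⟨i, rfl⟩
      refine ⟨Multiplicative.ofAdd (ee n i), ?_⟩
      rw [MonoidHom.comp_apply, hf]; rfl
    obtain ⟨w, hw⟩ := this (center_eq n ▸ hz)
    exact ⟨w, Subtype.ext hw⟩

/-- **Lemma A.3.** The center of `P_n` is generated by `x², b₁², …, b_{n+1}²`; it is
elementary abelian of order `2^{n+2}`, the quotient of `P_n` by its center is also
elementary abelian of order `2^{n+2}`, and in particular `g²` is central and `g⁴ = 1`
for every `g ∈ P_n`. -/
theorem statement12 (n : ℕ) :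
    Subgroup.center (Pn n) = Subgroup.closure (pnSq n) ∧
      Nonempty (Subgroup.center (Pn n) ≃* Multiplicative (Fin (n + 2) → ZMod 2)) ∧
      Nonempty ((Pn n ⧸ Subgroup.center (Pn n)) ≃* Multiplicative (Fin (n + 2) → ZMod 2)) ∧
      ∀ g : Pn n, g ^ 2 ∈ Subgroup.center (Pn n) ∧ g ^ 4 = 1 := by
  obtain ⟨f, hf⟩ := theta_ex n
  have hV : ∀ v : Multiplicative (VV n), v ^ 2 = 1 := by
    intro v
    rw [pow_two]
    exact vv_add_self v.toAdd
  refine ⟨center_eq n, ⟨(MulEquiv.ofBijective f hf).symm⟩, ⟨?_⟩, ?_⟩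
  · exact (QuotientGroup.quotientMulEquivOfEq (ker_eq_s12 n).symm).trans
      (QuotientGroup.quotientKerEquivOfSurjective (ppi n) (ppi_surj n))
  · intro g
    have h2 : g ^ 2 ∈ Subgroup.center (Pn n) := by
      rw [← ker_eq_s12, MonoidHom.mem_ker, map_pow, hV]
    refine ⟨h2, ?_⟩
    obtain ⟨w, hw⟩ := hf.2 ⟨g ^ 2, h2⟩
    have h3 : (⟨g ^ 2, h2⟩ : Subgroup.center (Pn n)) ^ 2 = 1 := by
      rw [← hw, ← map_pow, hV, map_one]
    have h4 := congrArg Subtype.val h3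
    change (g ^ 2) ^ 2 = 1 at h4
    rw [← pow_mul] at h4
    exact h4
end
end
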